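/- Fix σ² > 0, n ∈ ℕ, and let f : ℝ → ℝ be continuous with compact support. For each ε > 0 there is δ > 0 such that: if X = (X₁,…,X_n) is a centered multivariate normal with |Cov(X_i, X_j) − σ² δ_{ij}| < δ for all i,j, and Y₁,…,Y_n are i.i.d. N(0,σ²), then |log( E exp(∑_{i=1}^n f(X_i)) / ∏_{i=1}^n E e^{f(Y_i)} )| < ε. -/

import Mathlib

open MeasureTheory ProbabilityTheory Real

/-- A random vector `X : Ω → ι → ℝ` is a centered Gaussian vector with covariance matrix `C`
(under `P`) if every linear combination of its coordinates is a centered real Gaussian with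
the corresponding variance. -/
def IsCenteredGaussianCov {Ω ι : Type*} [MeasurableSpace Ω] [Fintype ι]
    (P : Measure Ω) (X : Ω → ι → ℝ) (C : ι → ι → ℝ) : Prop :=
  ∀ l : ι → ℝ,
    P.map (fun ω => ∑ i, l i * X ω i)
      = gaussianReal 0 (∑ i, ∑ j, l i * l j * C i j).toNNReal

open Complex in
/-- The characteristic function of a centered Gaussian vector. -/
lemma IsCenteredGaussianCov.charFun_map_toLp {Ω ι : Type*} [MeasurableSpace Ω] [Fintype ι]
    {P : Measure Ω} {X : Ω → ι → ℝ} {C : ι → ι → ℝ}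
    (hX : Measurable X) (h : IsCenteredGaussianCov P X C) (t : EuclideanSpace ℝ ι) :
    charFun (P.map fun ω => WithLp.toLp 2 (X ω)) t
      = cexp (-(((∑ i, ∑ j, t i * t j * C i j).toNNReal : ℝ) : ℂ) / 2) := by
  have hlin : charFun (P.map fun ω => ∑ i, t i * X ω i) 1
      = charFun (P.map fun ω => WithLp.toLp 2 (X ω)) t := by
    rw [charFun_apply, charFun_apply, integral_map (by fun_prop) (by fun_prop),
      integral_map (by fun_prop) (by fun_prop)]
    simp [PiLp.inner_apply]
  rw [← hlin, h t, charFun_gaussianReal]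
  congr 1
  push_cast
  ring

open Complex in
/-- The characteristic function of a product of identical centered Gaussians. -/
lemma charFun_map_toLp_pi_gaussianReal {ι : Type*} [Fintype ι] (v : NNReal)
    (t : EuclideanSpace ℝ ι) :
    charFun ((Measure.pi fun _ : ι => gaussianReal 0 v).map (WithLp.toLp 2)) t
      = cexp (-((∑ i, t i * t i * v : ℝ) : ℂ) / 2) := by
  rw [charFun_pi]
  simp_rw [charFun_gaussianReal]
  rw [← Complex.exp_sum]
  congr 1
  push_cast
  rw [← Finset.sum_neg_distrib, Finset.sum_div]
  refine Finset.sum_congr rfl fun i _ => ?_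
  ring

open Filter Topology in
/-- Centered Gaussian vectors whose covariances converge to `v` times the identity converge in
law to a vector of independent centered Gaussians of variance `v`. -/
lemma tendsto_integral_of_tendsto_cov {ι : Type*} [Fintype ι] [DecidableEq ι] (v : NNReal)
    (Ω : ℕ → Type*) [∀ k, MeasurableSpace (Ω k)] (P : ∀ k, Measure (Ω k))
    [∀ k, IsProbabilityMeasure (P k)] (X : ∀ k, Ω k → ι → ℝ) (C : ℕ → ι → ι → ℝ)
    (hX : ∀ k, Measurable (X k)) (h : ∀ k, IsCenteredGaussianCov (P k) (X k) (C k))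
    (hC : ∀ i j, Tendsto (fun k => C k i j) atTop (𝓝 (v * (if i = j then 1 else 0))))
    (g : BoundedContinuousFunction (ι → ℝ) ℝ) :
    Tendsto (fun k => ∫ ω, g (X k ω) ∂(P k)) atTop
      (𝓝 (∫ x, g x ∂(Measure.pi fun _ : ι => gaussianReal 0 v))) := by
  have hmeas : ∀ k, Measurable fun ω => WithLp.toLp 2 (X k ω) := fun k => by
    have := hX k
    fun_prop
  let μ : ℕ → ProbabilityMeasure (EuclideanSpace ℝ ι) := fun k =>
    ⟨(P k).map fun ω => WithLp.toLp 2 (X k ω),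
      Measure.isProbabilityMeasure_map (hmeas k).aemeasurable⟩
  let μ₀ : ProbabilityMeasure (EuclideanSpace ℝ ι) :=
    ⟨(Measure.pi fun _ : ι => gaussianReal 0 v).map (WithLp.toLp 2),
      Measure.isProbabilityMeasure_map (by fun_prop)⟩
  have hμ : Tendsto μ atTop (𝓝 μ₀) := by
    refine ProbabilityMeasure.tendsto_of_tendsto_charFun fun t => ?_
    have hq : Tendsto (fun k => ∑ i, ∑ j, t i * t j * C k i j) atTop
        (𝓝 (∑ i, t i * t i * v)) := by
      have hs : ∑ i, t i * t i * (v : ℝ)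
          = ∑ i, ∑ j, t i * t j * (v * (if i = j then 1 else 0)) := by
        simp
      rw [hs]
      exact tendsto_finsetSum _ fun i _ => tendsto_finsetSum _ fun j _ => (hC i j).const_mul _
    have hnn : 0 ≤ ∑ i, t i * t i * (v : ℝ) :=
      Finset.sum_nonneg fun i _ => mul_nonneg (mul_self_nonneg _) v.2
    have hq' : Tendsto (fun k => ((∑ i, ∑ j, t i * t j * C k i j).toNNReal : ℝ)) atTop
        (𝓝 (∑ i, t i * t i * v)) := by
      have := (NNReal.continuous_coe.tendsto _).comp (tendsto_real_toNNReal hq)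
      rwa [Real.coe_toNNReal _ hnn] at this
    have hk : ∀ k, charFun (μ k : Measure (EuclideanSpace ℝ ι)) t
        = Complex.exp (-(((∑ i, ∑ j, t i * t j * C k i j).toNNReal : ℝ) : ℂ) / 2) :=
      fun k => (h k).charFun_map_toLp (hX k) t
    have h0 : charFun (μ₀ : Measure (EuclideanSpace ℝ ι)) t
        = Complex.exp (-((∑ i, t i * t i * v : ℝ) : ℂ) / 2) :=
      charFun_map_toLp_pi_gaussianReal v t
    simp_rw [hk, h0]
    have hcont : Continuous fun x : ℝ => Complex.exp (-(x : ℂ) / 2) := by fun_prop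
    exact (hcont.tendsto _).comp hq'
  have hint := ProbabilityMeasure.tendsto_iff_forall_integral_tendsto.1 hμ
    (g.compContinuous ⟨WithLp.ofLp, by fun_prop⟩)
  have hk : ∀ k, ∫ x, g.compContinuous ⟨WithLp.ofLp, by fun_prop⟩ x
      ∂(μ k : Measure (EuclideanSpace ℝ ι)) = ∫ ω, g (X k ω) ∂(P k) := fun k =>
    integral_map (hmeas k).aemeasurable
      (BoundedContinuousFunction.continuous _).aestronglyMeasurable
  have h0 : ∫ x, g.compContinuous ⟨WithLp.ofLp, by fun_prop⟩ x
      ∂(μ₀ : Measure (EuclideanSpace ℝ ι))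
      = ∫ x, g x ∂(Measure.pi fun _ : ι => gaussianReal 0 v) :=
    integral_map (by fun_prop) (BoundedContinuousFunction.continuous _).aestronglyMeasurable
  simpa only [hk, h0] using hint

/-- Nearly independent multivariate normals can be replaced by i.i.d. ones:
for `f` continuous with compact support and `ε > 0` there is `δ > 0` such that whenever
`X = (X₁,…,Xₙ)` is centered Gaussian with `|Cov(X_i,X_j) - σ² δ_{ij}| < δ`,
`|log (E exp(∑ f(X_i)) / (∫ e^{f} dN(0,σ²))^n)| < ε`, the denominator being
`∏ᵢ E e^{f(Y_i)}` for `Y₁,…,Yₙ` i.i.d. `N(0,σ²)`. -/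
theorem nearly_independent_gaussian_comparison
    (σ2 : ℝ) (hσ2 : 0 < σ2) (n : ℕ) (f : ℝ → ℝ)
    (hf : Continuous f) (hsupp : HasCompactSupport f) :
    ∀ ε : ℝ, 0 < ε → ∃ δ : ℝ, 0 < δ ∧
      ∀ (Ω : Type) (_ : MeasurableSpace Ω) (P : Measure Ω),
        IsProbabilityMeasure P →
        ∀ (X : Ω → Fin n → ℝ) (C : Fin n → Fin n → ℝ),
          Measurable X →
          IsCenteredGaussianCov P X C →
          (∀ i j, |C i j - σ2 * (if i = j then 1 else 0)| < δ) →
          |Real.log ((∫ ω, Real.exp (∑ i, f (X ω i)) ∂P) /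
              (∫ x, Real.exp (f x) ∂(gaussianReal 0 σ2.toNNReal)) ^ n)| < ε := by
  intro ε hε
  by_contra! hcon
  choose Ω mΩ P hP X C hX hG hC hbad using
    fun k : ℕ => hcon (1 / ((k : ℝ) + 1)) Nat.one_div_pos_of_nat
  have hv : (σ2.toNNReal : ℝ) = σ2 := Real.coe_toNNReal _ hσ2.le
  have hClim : ∀ i j, Filter.Tendsto (fun k => C k i j) Filter.atTop
      (nhds (σ2.toNNReal * (if i = j then 1 else 0))) := fun i j => by
    rw [hv, tendsto_iff_dist_tendsto_zero]
    exact squeeze_zero (fun _ => dist_nonneg) (fun k => (hC k i j).le)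
      tendsto_one_div_add_atTop_nhds_zero_nat
  obtain ⟨M, hM⟩ := hsupp.exists_bound_of_continuous hf
  have hfM : ∀ x, f x ≤ M := fun x => (le_abs_self _).trans (hM x)
  have hexp : ∀ x : Fin n → ℝ, ‖Real.exp (∑ i, f (x i))‖ ≤ Real.exp (∑ _i : Fin n, M) := fun x => by
    rw [Real.norm_of_nonneg (Real.exp_pos _).le]
    exact Real.exp_le_exp.2 (Finset.sum_le_sum fun i _ => hfM _)
  have hlim := tendsto_integral_of_tendsto_cov σ2.toNNReal Ω P X C hX hG hClim
    (BoundedContinuousFunction.ofNormedAddCommGroup _ (by fun_prop) _ hexp)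
  simp only [BoundedContinuousFunction.coe_ofNormedAddCommGroup] at hlim
  have hprod : ∫ x : Fin n → ℝ, Real.exp (∑ i, f (x i))
      ∂(Measure.pi fun _ => gaussianReal 0 σ2.toNNReal)
      = (∫ x, Real.exp (f x) ∂(gaussianReal 0 σ2.toNNReal)) ^ n := by
    simp_rw [Real.exp_sum]
    rw [integral_fintype_prod_eq_prod (fun _ x => Real.exp (f x))]
    simp
  have hpos : 0 < (∫ x, Real.exp (f x) ∂(gaussianReal 0 σ2.toNNReal)) ^ n := by
    refine pow_pos (integral_exp_pos ?_) n
    refine Integrable.of_bound (by fun_prop) (Real.exp M) (.of_forall fun x => ?_)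
    rw [Real.norm_of_nonneg (Real.exp_pos _).le]
    exact Real.exp_le_exp.2 (hfM x)
  rw [hprod] at hlim
  have hlog := ((hlim.div_const _).log (div_ne_zero hpos.ne' hpos.ne')).abs
  rw [div_self hpos.ne', Real.log_one, abs_zero] at hlog
  exact hε.not_ge (ge_of_tendsto' hlog hbad)
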